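/- arXiv:2511.15959 — 2 statements merged into one kernel-verified Lean document; each statement's English description precedes it below -/
import Mathlib

section
/- Let n be a natural number, H V : ℝ → Matrix (Fin n) (Fin n) ℂ with V differentiable and V(t) invertible for every t, and let ψ : ℝ → (Fin n → ℂ) be differentiable satisfying the Schrödinger equation i · deriv ψ t = (H t).mulVec (ψ t) for all t. Define b t = (V t).mulVec (ψ t) and M t = i • (deriv V t) * (V t)⁻¹ + (V t) * (H t) * (V t)⁻¹. Then b is differentiable and i · deriv b t = (M t).mulVec (b t) for all t. -/
/- Equip matrices with the entrywise (Pi) norm, so that `deriv` of a matrix-valued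
function of a real variable is the entrywise derivative. -/
attribute [local instance] Matrix.normedAddCommGroup Matrix.normedSpace

/-- Product rule for the matrix-vector product. -/
theorem HasDerivAt.matrix_mulVec {m n : Type*} [Fintype m] [Fintype n]
    {A : ℝ → Matrix m n ℂ} {A' : Matrix m n ℂ} {v : ℝ → n → ℂ} {v' : n → ℂ} {t : ℝ}
    (hA : HasDerivAt A A' t) (hv : HasDerivAt v v' t) :
    HasDerivAt (fun s => (A s).mulVec (v s)) (A'.mulVec (v t) + (A t).mulVec v') t := by
  rw [hasDerivAt_pi]
  intro i
  have hentry (j : n) : HasDerivAt (fun s => A s i j) (A' i j) t :=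
    hasDerivAt_pi.1 (hasDerivAt_pi.1 hA i) j
  simpa only [Matrix.mulVec, dotProduct, Pi.add_apply, Pi.mul_apply, Finset.sum_add_distrib] using
    HasDerivAt.fun_sum fun j (_ : j ∈ Finset.univ) => (hentry j).mul (hasDerivAt_pi.1 hv j)

/-- **Gauge-transformation lemma.** If `i ψ' = H ψ` and `b = V ψ` with `V`
differentiable and pointwise invertible, then `i b' = M b` where
`M = i V' V⁻¹ + V H V⁻¹`. -/
theorem gauge_transformation_schrodinger {n : ℕ}
    (H V : ℝ → Matrix (Fin n) (Fin n) ℂ) (ψ : ℝ → (Fin n → ℂ))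
    (hV : Differentiable ℝ V) (hVinv : ∀ t, IsUnit (V t))
    (hψ : Differentiable ℝ ψ)
    (hSE : ∀ t, Complex.I • deriv ψ t = (H t).mulVec (ψ t)) :
    let b : ℝ → (Fin n → ℂ) := fun t => (V t).mulVec (ψ t)
    let M : ℝ → Matrix (Fin n) (Fin n) ℂ :=
      fun t => Complex.I • (deriv V t) * (V t)⁻¹ + (V t) * (H t) * (V t)⁻¹
    Differentiable ℝ b ∧ ∀ t, Complex.I • deriv b t = (M t).mulVec (b t) := by
  intro b M
  have hb (t : ℝ) : HasDerivAt b ((deriv V t).mulVec (ψ t) + (V t).mulVec (deriv ψ t)) t :=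
    (hV t).hasDerivAt.matrix_mulVec (hψ t).hasDerivAt
  refine ⟨fun t => (hb t).differentiableAt, fun t => ?_⟩
  have hinv : (V t)⁻¹ * V t = 1 :=
    Matrix.nonsing_inv_mul _ ((Matrix.isUnit_iff_isUnit_det _).1 (hVinv t))
  have hcancel : M t * V t = Complex.I • deriv V t + V t * H t := by
    simp only [M, add_mul, mul_assoc, hinv, mul_one]
  rw [(hb t).deriv, smul_add, ← Matrix.mulVec_smul (V t), hSE, Matrix.mulVec_mulVec,
    Matrix.mulVec_mulVec, hcancel, Matrix.add_mulVec, Matrix.smul_mulVec]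
end

section
/- Let g₀, ω_a, Δω be real numbers and set ω₋ = ω_a - Δω, ω₊ = ω_a + Δω. Define H : ℝ → Matrix (Fin 5) (Fin 5) ℂ by H t = g₀ • ![![0, e^{-i ω₋ t}, e^{-i ω₊ t}, 0, 0], ![e^{i ω₋ t}, 0, 0, e^{i ω₊ t}, 0], ![e^{i ω₊ t}, 0, 0, 0, e^{i ω₋ t}], ![0, e^{-i ω₊ t}, 0, 0, 0], ![0, 0, e^{-i ω₋ t}, 0, 0]] and V : ℝ → Matrix (Fin 5) (Fin 5) ℂ by V t = diagonal ![1, e^{-i ω₋ t}, e^{-i ω₊ t}, e^{2i Δω t}, e^{-2i Δω t}]. Then for all real t, i • (deriv V t) * (V t)⁻¹ + (V t) * (H t) * (V t)⁻¹ = M, where M is the constant matrix ![![0, g₀, g₀, 0, 0], ![g₀, ω₋, 0, g₀, 0], ![g₀, 0, ω₊, 0, g₀], ![0, g₀, 0, -2Δω, 0], ![0, 0, g₀, 0, 2Δω]]. -/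
theorem hasDerivAt_diagonal_exp {n : Type*} [Fintype n] [DecidableEq n] (c : n → ℂ) (t : ℝ) :
    HasDerivAt (fun s : ℝ => Matrix.diagonal fun i => Complex.exp (c i * (s : ℂ)))
      (Matrix.diagonal fun i => c i * Complex.exp (c i * (t : ℂ))) t := by
  refine hasDerivAt_pi.2 fun i => hasDerivAt_pi.2 fun j => ?_
  by_cases h : i = j
  · subst h
    have hlin : HasDerivAt (fun s : ℝ => c i * (s : ℂ)) (c i) t := by
      simpa using (Complex.ofRealCLM.hasDerivAt (x := t)).const_mul (c i)
    simpa [mul_comm] using hlin.cexp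
  · simpa [Matrix.diagonal_apply_ne _ h] using hasDerivAt_const t (0 : ℂ)

theorem deriv_diagonal_exp {n : Type*} [Fintype n] [DecidableEq n] (c : n → ℂ) (t : ℝ) :
    deriv (fun s : ℝ => Matrix.diagonal fun i => Complex.exp (c i * (s : ℂ))) t =
      Matrix.diagonal fun i => c i * Complex.exp (c i * (t : ℂ)) := by
  have h : HasDerivAt (F := n → n → ℂ)
      (fun s : ℝ => Matrix.diagonal fun i => Complex.exp (c i * (s : ℂ)))
      (Matrix.diagonal fun i => c i * Complex.exp (c i * (t : ℂ))) t :=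
    hasDerivAt_diagonal_exp c t
  exact h.deriv

theorem inv_diagonal_exp {n : Type*} [Fintype n] [DecidableEq n] (z : n → ℂ) :
    (Matrix.diagonal fun i => Complex.exp (z i))⁻¹ =
      Matrix.diagonal fun i => Complex.exp (-z i) := by
  refine Matrix.inv_eq_right_inv ?_
  simp [Matrix.diagonal_mul_diagonal, ← Complex.exp_add]

/-- Entries of the Hamiltonian transformed by the diagonal gauge `exp (c i * t)`. -/
theorem gauge_transform_diagonal_exp_apply {n : Type*} [Fintype n] [DecidableEq n]
    (c : n → ℂ) (t : ℝ) (H : Matrix n n ℂ) (i j : n) :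
    (Complex.I • deriv (fun s : ℝ => Matrix.diagonal fun i => Complex.exp (c i * (s : ℂ))) t *
        (Matrix.diagonal fun i => Complex.exp (c i * (t : ℂ)))⁻¹ +
      (Matrix.diagonal fun i => Complex.exp (c i * (t : ℂ))) * H *
        (Matrix.diagonal fun i => Complex.exp (c i * (t : ℂ)))⁻¹) i j =
      (if i = j then Complex.I * c i else 0) +
        H i j * Complex.exp (c i * (t : ℂ) - c j * (t : ℂ)) := by
  rw [deriv_diagonal_exp, inv_diagonal_exp, Matrix.add_apply,
    Matrix.mul_diagonal, Matrix.mul_diagonal, Matrix.diagonal_mul, Matrix.smul_apply,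
    sub_eq_add_neg, Complex.exp_add]
  congr 1
  · by_cases h : i = j
    · subst h
      simp [mul_assoc, ← Complex.exp_add]
    · simp [h]
  · ring

/-- The diagonal gauge transformation with phases `χ = (0, -ω₋, -ω₊, 2Δω, -2Δω)` renders
the five-level constant-amplitude SDK Hamiltonian time independent:
`i V' V⁻¹ + V H V⁻¹ = M` with `M` constant. Here `ωa = ω_a` and `Δω` is the Raman
beat frequency, with `ω₋ = ωa - Δω` and `ω₊ = ωa + Δω`. -/
theorem sdk_five_level_gauge_time_independent (g₀ ωa Δω : ℝ) :
    let ωm : ℝ := ωa - Δω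
    let ωp : ℝ := ωa + Δω
    let H : ℝ → Matrix (Fin 5) (Fin 5) ℂ := fun t => (g₀ : ℂ) •
      !![0, Complex.exp (-(Complex.I * (ωm : ℂ) * (t : ℂ))),
            Complex.exp (-(Complex.I * (ωp : ℂ) * (t : ℂ))), 0, 0;
         Complex.exp (Complex.I * (ωm : ℂ) * (t : ℂ)), 0, 0,
            Complex.exp (Complex.I * (ωp : ℂ) * (t : ℂ)), 0;
         Complex.exp (Complex.I * (ωp : ℂ) * (t : ℂ)), 0, 0, 0,
            Complex.exp (Complex.I * (ωm : ℂ) * (t : ℂ));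
         0, Complex.exp (-(Complex.I * (ωp : ℂ) * (t : ℂ))), 0, 0, 0;
         0, 0, Complex.exp (-(Complex.I * (ωm : ℂ) * (t : ℂ))), 0, 0]
    let V : ℝ → Matrix (Fin 5) (Fin 5) ℂ := fun t => Matrix.diagonal
      ![1, Complex.exp (-(Complex.I * (ωm : ℂ) * (t : ℂ))),
           Complex.exp (-(Complex.I * (ωp : ℂ) * (t : ℂ))),
           Complex.exp (2 * Complex.I * (Δω : ℂ) * (t : ℂ)),
           Complex.exp (-(2 * Complex.I * (Δω : ℂ) * (t : ℂ)))]
    let M : Matrix (Fin 5) (Fin 5) ℂ :=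
      !![0, (g₀ : ℂ), (g₀ : ℂ), 0, 0;
         (g₀ : ℂ), (ωm : ℂ), 0, (g₀ : ℂ), 0;
         (g₀ : ℂ), 0, (ωp : ℂ), 0, (g₀ : ℂ);
         0, (g₀ : ℂ), 0, (-(2 * Δω) : ℂ), 0;
         0, 0, (g₀ : ℂ), 0, ((2 * Δω : ℝ) : ℂ)]
    ∀ t : ℝ, Complex.I • (deriv V t) * (V t)⁻¹ + (V t) * (H t) * (V t)⁻¹ = M := by
  intro ωm ωp H V M t
  let c : Fin 5 → ℂ := ![0, -(Complex.I * ωm), -(Complex.I * ωp), 2 * Complex.I * Δω,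
    -(2 * Complex.I * Δω)]
  have hV : V = fun s : ℝ => Matrix.diagonal fun i => Complex.exp (c i * (s : ℂ)) := by
    funext s
    refine congrArg Matrix.diagonal (funext fun i => ?_)
    fin_cases i <;> simp [c]
  have hp : (ωp : ℂ) = ωm + 2 * Δω := by
    simp only [ωp, ωm]
    push_cast
    ring
  rw [hV]
  ext i j
  rw [gauge_transform_diagonal_exp_apply c t (H t) i j]
  fin_cases i <;> fin_cases j <;>
    simp [H, M, c, hp, mul_assoc, ← Complex.exp_add] <;> ring_nf <;> simp
end
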